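/- Let n ≥ 1 and s ∈ ℕ ∪ {0}. There exists a constant C ≥ 1, independent of the ball, such that: if a is a (φ_0,∞,s)-atom associated with a ball B ⊂ ℝ^n, or a (1,∞,s)_{W_1}-atom associated with B, then C^{-1}a is a (Φ_1,∞,s)-atom associated with the same ball B. Equivalently, ‖χ_B‖_{L^{Φ_1}} ≤ C·‖χ_B‖_{L^{φ_0}} and ‖χ_B‖_{L^{Φ_1}} ≤ C·‖χ_B‖_{L^1_{W_1}} for every ball B ⊂ ℝ^n. -/

import Mathlib

open MeasureTheory Real
open scoped ENNReal Classical

noncomputable section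

/-- `ℝⁿ` as a Euclidean space. -/
abbrev Rn (n : ℕ) := EuclideanSpace ℝ (Fin n)

/-- The Musielak-Orlicz growth function `Φ_p`. -/
def Phi (n : ℕ) (p : ℝ) (x : Rn n) (t : ℝ) : ℝ :=
  if ∃ k : ℕ, (n : ℝ) * (1 / p - 1) = (k : ℝ) then
    t / (Real.log (Real.exp 1 + t) +
      (t * (1 + ‖x‖) ^ (n : ℝ)) ^ (1 - p) * (Real.log (Real.exp 1 + ‖x‖)) ^ p)
  else
    t / (Real.log (Real.exp 1 + t) + (t * (1 + ‖x‖) ^ (n : ℝ)) ^ (1 - p))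

/-- The Orlicz function `φ₀(t) = t / log(e+t)`. -/
def phi0 (t : ℝ) : ℝ := t / Real.log (Real.exp 1 + t)

/-- The weight `W_p`. -/
def Wp (n : ℕ) (p : ℝ) (x : Rn n) : ℝ :=
  if p = 1 then 1 / Real.log (Real.exp 1 + ‖x‖)
  else if ∃ k : ℕ, (n : ℝ) * (1 / p - 1) = (k : ℝ) then
    (1 + ‖x‖) ^ (-(n : ℝ) * (1 - p)) * (Real.log (Real.exp 1 + ‖x‖)) ^ (-p)
  else (1 + ‖x‖) ^ (-(n : ℝ) * (1 - p))

/-- Extension of `Φ_p(x, ·)` to `ℝ≥0∞`. -/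
def PhiE (n : ℕ) (p : ℝ) (x : Rn n) (t : ℝ≥0∞) : ℝ≥0∞ :=
  if t = ⊤ then ⊤ else ENNReal.ofReal (Phi n p x t.toReal)

/-- Extension of `φ₀` to `ℝ≥0∞`. -/
def phi0E (t : ℝ≥0∞) : ℝ≥0∞ :=
  if t = ⊤ then ⊤ else ENNReal.ofReal (phi0 t.toReal)

/-- The Luxemburg quasi-norm `‖·‖_{L^{Φ_p}}`. -/
def luxPhiNorm (n : ℕ) (p : ℝ) (F : Rn n → ℝ≥0∞) : ℝ≥0∞ :=
  sInf {lam : ℝ≥0∞ | 0 < lam ∧ (∫⁻ x : Rn n, PhiE n p x (F x / lam)) ≤ 1}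

/-- The Luxemburg norm `‖·‖_{L^{φ₀}}`. -/
def luxPhi0Norm (n : ℕ) (F : Rn n → ℝ≥0∞) : ℝ≥0∞ :=
  sInf {lam : ℝ≥0∞ | 0 < lam ∧ (∫⁻ x : Rn n, phi0E (F x / lam)) ≤ 1}

/-- The weighted quasi-norm `‖·‖_{L^p_{W_p}}`. -/
def wNorm (n : ℕ) (p : ℝ) (F : Rn n → ℝ≥0∞) : ℝ≥0∞ :=
  (∫⁻ x : Rn n, F x ^ p * ENNReal.ofReal (Wp n p x)) ^ (1 / p)

/-- The weighted norm `‖·‖_{L^1_{W_1}}`. -/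
def w1Norm (n : ℕ) (F : Rn n → ℝ≥0∞) : ℝ≥0∞ :=
  ∫⁻ x : Rn n, F x * ENNReal.ofReal (Wp n 1 x)

/-- The characteristic function of a set, `ℝ≥0∞`-valued. -/
def chi (n : ℕ) (B : Set (Rn n)) : Rn n → ℝ≥0∞ := B.indicator fun _ => 1


/-- An `(X, ∞, s)`-atom associated with the set `B`, where `normB` is `‖χ_B‖_X`:
a measurable function supported in `B`, bounded by `‖χ_B‖_X⁻¹`, with vanishing
moments up to order `s`. -/
def IsAtom' (n s : ℕ) (normB : ℝ≥0∞) (B : Set (Rn n)) (a : Rn n → ℂ) : Prop :=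
  Measurable a ∧ (∀ x, x ∉ B → a x = 0) ∧
  (∀ᵐ x : Rn n, (‖a x‖₊ : ℝ≥0∞) ≤ normB⁻¹) ∧
  ∀ α : Fin n → ℕ, (∑ i, α i) ≤ s →
    (∫ x : Rn n, a x * ∏ i, ((x i : ℝ) : ℂ) ^ (α i)) = 0

theorem one_le_log_exp_add {t : ℝ} (ht : 0 ≤ t) : 1 ≤ Real.log (Real.exp 1 + t) := by
  rw [Real.le_log_iff_exp_le (by positivity)]
  linarith

theorem Phi_one (n : ℕ) (x : Rn n) (t : ℝ) :
    Phi n 1 x t = t / (Real.log (Real.exp 1 + t) + Real.log (Real.exp 1 + ‖x‖)) := by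
  have h : ∃ k : ℕ, (n : ℝ) * (1 / 1 - 1) = (k : ℝ) := ⟨0, by norm_num⟩
  rw [Phi, if_pos h]
  norm_num

theorem PhiE_one_le_phi0E (n : ℕ) (x : Rn n) (t : ℝ≥0∞) : PhiE n 1 x t ≤ phi0E t := by
  unfold PhiE phi0E
  split_ifs
  · exact le_rfl
  · have h1 := one_le_log_exp_add (t := t.toReal) ENNReal.toReal_nonneg
    have h2 := one_le_log_exp_add (norm_nonneg x)
    rw [Phi_one, phi0]
    gcongr
    linarith

theorem Wp_one_pos (n : ℕ) (x : Rn n) : 0 < Wp n 1 x := by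
  have h := one_le_log_exp_add (norm_nonneg x)
  rw [Wp, if_pos rfl]
  positivity

theorem measurable_Wp_one (n : ℕ) : Measurable (Wp n 1) := by
  have h : Wp n 1 = fun x : Rn n => 1 / Real.log (Real.exp 1 + ‖x‖) := by
    ext x
    rw [Wp, if_pos rfl]
  rw [h]
  fun_prop

theorem PhiE_one_le_mul_Wp (n : ℕ) (x : Rn n) (t : ℝ≥0∞) :
    PhiE n 1 x t ≤ t * ENNReal.ofReal (Wp n 1 x) := by
  unfold PhiE
  split_ifs with ht
  · rw [ht, ENNReal.top_mul (by simpa using Wp_one_pos n x)]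
  · have h1 := one_le_log_exp_add (t := t.toReal) ENNReal.toReal_nonneg
    have h2 := one_le_log_exp_add (norm_nonneg x)
    nth_rewrite 2 [← ENNReal.ofReal_toReal ht]
    rw [← ENNReal.ofReal_mul ENNReal.toReal_nonneg, Phi_one, Wp, if_pos rfl, mul_one_div]
    gcongr
    linarith

theorem luxPhiNorm_one_le_luxPhi0Norm (n : ℕ) (F : Rn n → ℝ≥0∞) :
    luxPhiNorm n 1 F ≤ luxPhi0Norm n F :=
  sInf_le_sInf fun _ h =>
    ⟨h.1, (lintegral_mono fun x => PhiE_one_le_phi0E n x _).trans h.2⟩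

theorem luxPhiNorm_one_le_w1Norm (n : ℕ) (F : Rn n → ℝ≥0∞) (hF : w1Norm n F ≠ 0) :
    luxPhiNorm n 1 F ≤ w1Norm n F := by
  refine sInf_le ⟨pos_iff_ne_zero.mpr hF, ?_⟩
  calc ∫⁻ x : Rn n, PhiE n 1 x (F x / w1Norm n F)
      ≤ ∫⁻ x : Rn n, (w1Norm n F)⁻¹ * (F x * ENNReal.ofReal (Wp n 1 x)) :=
        lintegral_mono fun x => (PhiE_one_le_mul_Wp n x _).trans_eq (by
          rw [div_eq_mul_inv, mul_comm (F x), mul_assoc])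
    _ = (w1Norm n F)⁻¹ * w1Norm n F :=
        lintegral_const_mul' _ _ (ENNReal.inv_ne_top.mpr hF)
    _ ≤ 1 := ENNReal.inv_mul_le_one _

theorem w1Norm_chi_ball_ne_zero (n : ℕ) (c : Rn n) {r : ℝ} (hr : 0 < r) :
    w1Norm n (chi n (Metric.ball c r)) ≠ 0 := by
  have hm : Measurable (fun x : Rn n =>
      chi n (Metric.ball c r) x * ENNReal.ofReal (Wp n 1 x)) :=
    (measurable_const.indicator measurableSet_ball).mul (measurable_Wp_one n).ennreal_ofReal
  rw [w1Norm, ← pos_iff_ne_zero, lintegral_pos_iff_support hm]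
  refine (Metric.measure_ball_pos volume c hr).trans_le (measure_mono fun x hx => ?_)
  simp [chi, hx, Wp_one_pos n x]

theorem IsAtom'.mono {n s : ℕ} {N M : ℝ≥0∞} {B : Set (Rn n)} {a : Rn n → ℂ}
    (ha : IsAtom' n s N B a) (h : M ≤ N) : IsAtom' n s M B a :=
  ⟨ha.1, ha.2.1, ha.2.2.1.mono fun _ hx => hx.trans (ENNReal.inv_le_inv.mpr h), ha.2.2.2⟩

/-- Every `(φ₀,∞,s)`-atom or `(1,∞,s)_{W_1}`-atom is, up to a uniform constant,
a `(Φ_1,∞,s)`-atom; equivalently `‖χ_B‖_{L^{Φ_1}} ≲ ‖χ_B‖_{L^{φ₀}}` and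
`‖χ_B‖_{L^{Φ_1}} ≲ ‖χ_B‖_{L^1_{W_1}}`. -/
theorem statement10 (n s : ℕ) (hn : 1 ≤ n) :
    ∃ C : ℝ, 1 ≤ C ∧ ∀ (c : Rn n) (r : ℝ), 0 < r →
      (∀ a : Rn n → ℂ,
        IsAtom' n s (luxPhi0Norm n (chi n (Metric.ball c r))) (Metric.ball c r) a →
        IsAtom' n s (luxPhiNorm n 1 (chi n (Metric.ball c r))) (Metric.ball c r)
          (fun x => (C : ℂ)⁻¹ * a x)) ∧
      (∀ a : Rn n → ℂ,
        IsAtom' n s (w1Norm n (chi n (Metric.ball c r))) (Metric.ball c r) a →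
        IsAtom' n s (luxPhiNorm n 1 (chi n (Metric.ball c r))) (Metric.ball c r)
          (fun x => (C : ℂ)⁻¹ * a x)) ∧
      luxPhiNorm n 1 (chi n (Metric.ball c r)) ≤
        ENNReal.ofReal C * luxPhi0Norm n (chi n (Metric.ball c r)) ∧
      luxPhiNorm n 1 (chi n (Metric.ball c r)) ≤
        ENNReal.ofReal C * w1Norm n (chi n (Metric.ball c r)) := by
  have h0 := fun c r => luxPhiNorm_one_le_luxPhi0Norm n (chi n (Metric.ball c r))
  refine ⟨1, le_rfl, fun c r hr => ?_⟩
  have h1 := luxPhiNorm_one_le_w1Norm n _ (w1Norm_chi_ball_ne_zero n c hr)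
  refine ⟨fun a ha => ?_, fun a ha => ?_, ?_, ?_⟩
  · simpa using ha.mono (h0 c r)
  · simpa using ha.mono h1
  · simpa using h0 c r
  · simpa using h1
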